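/- Main theorem: Let A be a 2×2 integer expanding matrix with |det A| = 3, k a nonzero integer, v ∈ ℤ² with {v, Av} linearly independent, and 𝒟 = {0, v, kAv}. Then the self-affine set T(A,𝒟) is connected if and only if k = 1 or k = −1. -/

import Mathlib

open Matrix

/-- `A` has integer entries. -/
def IsIntMat (A : Matrix (Fin 2) (Fin 2) ℝ) : Prop :=
  ∀ i j, ∃ m : ℤ, A i j = (m : ℝ)

/-- All (complex) eigenvalues of `A` have modulus strictly larger than `1`. -/
def IsExpandingMat (A : Matrix (Fin 2) (Fin 2) ℝ) : Prop :=
  ∀ μ ∈ spectrum ℂ (A.map (algebraMap ℝ ℂ)), 1 < ‖μ‖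

/-- The self-affine set `T(A, D) = {∑_{i≥1} A^{-i} d_i : d_i ∈ D}`. -/
noncomputable def selfAffine (A : Matrix (Fin 2) (Fin 2) ℝ) (D : Set (Fin 2 → ℝ)) :
    Set (Fin 2 → ℝ) :=
  { x | ∃ d : ℕ → (Fin 2 → ℝ), (∀ n, d n ∈ D) ∧
      HasSum (fun n => (A⁻¹ ^ (n + 1)) *ᵥ d n) x }

theorem abs_le_of_self_improving {z : ℕ → ℝ} {θ C : ℝ} (hθ : θ < 1)
    (hz : ∃ M, ∀ n, |z n| ≤ M)
    (h : ∀ M, (∀ n, |z n| ≤ M) → ∀ n, |z n| ≤ (1 - θ) * C + θ * M) (n : ℕ) : |z n| ≤ C := by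
  obtain ⟨M₀, hM₀⟩ := hz
  have hb : BddAbove (Set.range fun n => |z n|) := ⟨M₀, by rintro _ ⟨n, rfl⟩; exact hM₀ n⟩
  have hle : ∀ n, |z n| ≤ ⨆ n, |z n| := le_ciSup hb
  have hsup : (⨆ n, |z n|) ≤ (1 - θ) * C + θ * ⨆ n, |z n| := ciSup_le (h _ hle)
  have : (1 - θ) * ((⨆ n, |z n|) - C) ≤ 0 := by linarith
  nlinarith [hle n, nonpos_of_mul_nonpos_right this (by linarith)]

/-- An orbit of the affine recursion `s ↦ A s - w` in coordinates with respect to `v, A v`, where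
`A² = t A - δ` and the coordinates `(a, B)` of `w` obey the constraints valid for differences of
the digits `0, v, k A v` with `k ≥ 2`. -/
structure IsOrbit (t δ K : ℝ) (x y a B : ℕ → ℝ) : Prop where
  fst_succ : ∀ n, x (n + 1) = -δ * y n - a n
  snd_succ : ∀ n, y (n + 1) = x n + t * y n - B n
  abs_fst : ∀ n, |a n| ≤ 1
  abs_snd : ∀ n, |B n| ≤ K
  abs_add : ∀ n, |2 * a n + B n| ≤ K

theorem IsOrbit.abs_le_of_det_three {t K : ℝ} {x y a B : ℕ → ℝ} (h : IsOrbit t 3 K x y a B)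
    (hK : 2 ≤ K) (ht : t = 0 ∨ t = 1 ∨ t = -1 ∨ t = 2 ∨ t = -2 ∨ t = 3 ∨ t = -3)
    (hy : ∃ M, ∀ n, |y n| ≤ M) (n : ℕ) : |y n| ≤ 2 * K := by
  refine abs_le_of_self_improving (θ := 1 / 6) (by norm_num) hy (fun M hM n => ?_) n
  have e0 := h.fst_succ n
  have e1 := h.fst_succ (n + 1)
  have e2 := h.fst_succ (n + 2)
  have e3 := h.fst_succ (n + 3)
  have e4 := h.fst_succ (n + 4)
  have e5 := h.fst_succ (n + 5)
  have f0 := h.snd_succ n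
  have f1 := h.snd_succ (n + 1)
  have f2 := h.snd_succ (n + 2)
  have f3 := h.snd_succ (n + 3)
  have f4 := h.snd_succ (n + 4)
  have f5 := h.snd_succ (n + 5)
  have f6 := h.snd_succ (n + 6)
  have a0 := abs_le.1 (h.abs_fst n)
  have a1 := abs_le.1 (h.abs_fst (n + 1))
  have a2 := abs_le.1 (h.abs_fst (n + 2))
  have a3 := abs_le.1 (h.abs_fst (n + 3))
  have a4 := abs_le.1 (h.abs_fst (n + 4))
  have a5 := abs_le.1 (h.abs_fst (n + 5))
  have b0 := abs_le.1 (h.abs_snd n)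
  have b1 := abs_le.1 (h.abs_snd (n + 1))
  have b2 := abs_le.1 (h.abs_snd (n + 2))
  have b3 := abs_le.1 (h.abs_snd (n + 3))
  have b4 := abs_le.1 (h.abs_snd (n + 4))
  have b5 := abs_le.1 (h.abs_snd (n + 5))
  have b6 := abs_le.1 (h.abs_snd (n + 6))
  have c0 := abs_le.1 (h.abs_add n)
  have c1 := abs_le.1 (h.abs_add (n + 1))
  have c2 := abs_le.1 (h.abs_add (n + 2))
  have c3 := abs_le.1 (h.abs_add (n + 3))
  have c4 := abs_le.1 (h.abs_add (n + 4))
  have c5 := abs_le.1 (h.abs_add (n + 5))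
  have m6 := abs_le.1 (hM (n + 6))
  have m7 := abs_le.1 (hM (n + 7))
  rw [abs_le]
  rcases ht with rfl | rfl | rfl | rfl | rfl | rfl | rfl <;> constructor <;> linarith

theorem IsOrbit.not_bounded_of_det_three {t K : ℝ} {x y a B : ℕ → ℝ} (h : IsOrbit t 3 K x y a B)
    (hK : 2 ≤ K) (ht : t = 0 ∨ t = 1 ∨ t = -1 ∨ t = 2 ∨ t = -2 ∨ t = 3 ∨ t = -3)
    (hx0 : x 0 = 0 ∨ x 0 = -1) (hy0 : y 0 = K) : ¬ ∃ M, ∀ n, |y n| ≤ M := by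
  intro hy
  have hM := h.abs_le_of_det_three hK ht hy
  have e0 := h.fst_succ 0
  have e1 := h.fst_succ 1
  have e2 := h.fst_succ 2
  have e3 := h.fst_succ 3
  have e4 := h.fst_succ 4
  have e5 := h.fst_succ 5
  have f0 := h.snd_succ 0
  have f1 := h.snd_succ 1
  have f2 := h.snd_succ 2
  have f3 := h.snd_succ 3
  have f4 := h.snd_succ 4
  have f5 := h.snd_succ 5
  have f6 := h.snd_succ 6
  have a0 := abs_le.1 (h.abs_fst 0)
  have a1 := abs_le.1 (h.abs_fst 1)
  have a2 := abs_le.1 (h.abs_fst 2)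
  have a3 := abs_le.1 (h.abs_fst 3)
  have a4 := abs_le.1 (h.abs_fst 4)
  have a5 := abs_le.1 (h.abs_fst 5)
  have b0 := abs_le.1 (h.abs_snd 0)
  have b1 := abs_le.1 (h.abs_snd 1)
  have b2 := abs_le.1 (h.abs_snd 2)
  have b3 := abs_le.1 (h.abs_snd 3)
  have b4 := abs_le.1 (h.abs_snd 4)
  have b5 := abs_le.1 (h.abs_snd 5)
  have b6 := abs_le.1 (h.abs_snd 6)
  have c0 := abs_le.1 (h.abs_add 0)
  have c1 := abs_le.1 (h.abs_add 1)
  have c2 := abs_le.1 (h.abs_add 2)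
  have c3 := abs_le.1 (h.abs_add 3)
  have c4 := abs_le.1 (h.abs_add 4)
  have c5 := abs_le.1 (h.abs_add 5)
  have m6 := abs_le.1 (hM 6)
  have m7 := abs_le.1 (hM 7)
  simp only [zero_add, Nat.reduceAdd] at *
  rcases hx0 with hx0 | hx0 <;> rcases ht with rfl | rfl | rfl | rfl | rfl | rfl | rfl <;> linarith

theorem exists_root_near_two_three : ∃ r : ℝ, r ^ 2 = r + 3 ∧ 23 / 10 ≤ r := by
  refine ⟨(1 + √13) / 2, ?_, ?_⟩
  · nlinarith [Real.sq_sqrt (show (0 : ℝ) ≤ 13 by norm_num)]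
  · have : (36 / 10 : ℝ) ≤ √13 := Real.le_sqrt_of_sq_le (by norm_num)
    linarith

theorem IsOrbit.not_bounded_of_det_neg_three {t K : ℝ} {x y a B : ℕ → ℝ}
    (h : IsOrbit t (-3) K x y a B) (hK : 2 ≤ K) (ht : t = 0 ∨ t = 1 ∨ t = -1)
    (hx0 : x 0 = 0 ∨ x 0 = -1) (hy0 : y 0 = K)
    (hx : ∃ M, ∀ n, |x n| ≤ M) (hy : ∃ M, ∀ n, |y n| ≤ M) : False := by
  obtain ⟨r, hr, hr'⟩ := exists_root_near_two_three
  have hL : 23 / 10 * K ≤ r * K := mul_le_mul_of_nonneg_right hr' (by linarith)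
  have hbdd : ∀ c : ℝ, ∃ M, ∀ n, |x n + c * y n| ≤ M := by
    obtain ⟨M₁, h₁⟩ := hx
    obtain ⟨M₂, h₂⟩ := hy
    refine fun c => ⟨M₁ + |c| * M₂, fun n => (abs_add_le _ _).trans ?_⟩
    rw [abs_mul]
    gcongr
    exacts [h₁ n, h₂ n]
  rcases ht with rfl | rfl | rfl
  · have hM : ∀ n, |y n| ≤ K := by
      refine abs_le_of_self_improving (θ := 1 / 3) (by norm_num) hy fun M hM n => ?_
      have e0 := h.fst_succ n
      have f1 := h.snd_succ (n + 1)
      have a0 := abs_le.1 (h.abs_fst n)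
      have b1 := abs_le.1 (h.abs_snd (n + 1))
      have m2 := abs_le.1 (hM (n + 2))
      rw [abs_le]
      constructor <;> linarith
    have e0 := h.fst_succ 0
    have e1 := h.fst_succ 1
    have e2 := h.fst_succ 2
    have f0 := h.snd_succ 0
    have f1 := h.snd_succ 1
    have f2 := h.snd_succ 2
    have f3 := h.snd_succ 3
    have a0 := abs_le.1 (h.abs_fst 0)
    have a1 := abs_le.1 (h.abs_fst 1)
    have a2 := abs_le.1 (h.abs_fst 2)
    have b0 := abs_le.1 (h.abs_snd 0)
    have b1 := abs_le.1 (h.abs_snd 1)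
    have b2 := abs_le.1 (h.abs_snd 2)
    have b3 := abs_le.1 (h.abs_snd 3)
    have c1 := abs_le.1 (h.abs_add 1)
    have c2 := abs_le.1 (h.abs_add 2)
    have m3 := abs_le.1 (hM 3)
    have m4 := abs_le.1 (hM 4)
    simp only [zero_add, Nat.reduceAdd] at *
    rcases hx0 with hx0 | hx0 <;> linarith
  · have hz : ∀ n, |x n + r * y n| ≤ 10 / 13 * (r * K) := by
      refine abs_le_of_self_improving (θ := 10 / 23) (by norm_num) (hbdd r) fun M hM n => ?_
      have hw : |a n + r * B n| ≤ r * K := by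
        have hb := abs_le.1 (h.abs_snd n)
        have hc := abs_le.1 (h.abs_add n)
        rw [abs_le]
        constructor <;> nlinarith
      have hstep : r * (x n + r * y n) = (x (n + 1) + r * y (n + 1)) + (a n + r * B n) := by
        rw [h.fst_succ, h.snd_succ]
        linear_combination y n * hr
      have hle : r * |x n + r * y n| ≤ M + r * K := by
        rw [← abs_of_nonneg (show 0 ≤ r by linarith), ← abs_mul,
          abs_of_nonneg (show 0 ≤ r by linarith), hstep]
        exact (abs_add_le _ _).trans (add_le_add (hM _) hw)
      nlinarith [abs_nonneg (x n + r * y n)]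
    have h0 := abs_le.1 (hz 0)
    rw [hy0] at h0
    rcases hx0 with hx0 | hx0 <;> rw [hx0] at h0 <;> linarith
  · have hz : ∀ n, |x n + -r * y n| ≤ 10 / 13 * (r * K + 1) := by
      refine abs_le_of_self_improving (θ := 10 / 23) (by norm_num) (hbdd (-r)) fun M hM n => ?_
      have hw : |a n + -r * B n| ≤ r * K + 1 := by
        have ha := abs_le.1 (h.abs_fst n)
        have hb := abs_le.1 (h.abs_snd n)
        rw [abs_le]
        constructor <;> nlinarith
      have hstep : -r * (x n + -r * y n) = (x (n + 1) + -r * y (n + 1)) + (a n + -r * B n) := by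
        rw [h.fst_succ, h.snd_succ]
        linear_combination y n * hr
      have hle : r * |x n + -r * y n| ≤ M + (r * K + 1) := by
        have : r * |x n + -r * y n| = |-r * (x n + -r * y n)| := by
          rw [abs_mul (-r), abs_neg, abs_of_nonneg (show 0 ≤ r by linarith)]
        rw [this, hstep]
        exact (abs_add_le _ _).trans (add_le_add (hM _) hw)
      nlinarith [abs_nonneg (x n + -r * y n)]
    have h0 := abs_le.1 (hz 0)
    rw [hy0] at h0
    rcases hx0 with hx0 | hx0 <;> rw [hx0] at h0 <;> linarith

/-- The powers of `B` are bounded by a summable sequence of operator norms. -/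
def HasSummablePowers (B : Matrix (Fin 2) (Fin 2) ℝ) : Prop :=
  ∃ c : ℕ → ℝ, Summable c ∧ ∀ n z, ‖(B ^ n) *ᵥ z‖ ≤ c n * ‖z‖

section Expanding

attribute [local instance] Matrix.linftyOpNormedRing Matrix.linftyOpNormedAlgebra

theorem summable_norm_pow_of_spectrum_lt_one {M : Matrix (Fin 2) (Fin 2) ℂ}
    (hM : ∀ μ ∈ spectrum ℂ M, ‖μ‖ < 1) : Summable fun n => ‖M ^ n‖ := by
  have hr : spectralRadius ℂ M < ((1 : NNReal) : ENNReal) :=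
    spectrum.spectralRadius_lt_of_forall_lt M fun μ hμ => by
      rw [← NNReal.coe_lt_coe]; simpa using hM μ hμ
  obtain ⟨r, hr₁, hr₂⟩ := ENNReal.lt_iff_exists_nnreal_btwn.1 hr
  have hev := (spectrum.pow_nnnorm_pow_one_div_tendsto_nhds_spectralRadius M).eventually_lt_const hr₁
  refine Summable.of_norm_bounded_eventually_nat
    (summable_geometric_of_lt_one r.coe_nonneg (by exact_mod_cast hr₂)) ?_
  filter_upwards [hev, Filter.eventually_gt_atTop 0] with n hn hn0
  have hle : (‖M ^ n‖₊ : ENNReal) ≤ (r : ENNReal) ^ n := by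
    have := ENNReal.rpow_le_rpow hn.le (Nat.cast_nonneg (α := ℝ) n)
    rwa [← ENNReal.rpow_mul, one_div, inv_mul_cancel₀ (by positivity), ENNReal.rpow_one,
      ENNReal.rpow_natCast] at this
  rw [norm_norm]
  exact_mod_cast hle

theorem IsExpandingMat.hasSummablePowers_inv {A : Matrix (Fin 2) (Fin 2) ℝ}
    (hA : IsExpandingMat A) (hdet : A.det ≠ 0) : HasSummablePowers A⁻¹ := by
  have hmul : A.map (algebraMap ℝ ℂ) * A⁻¹.map (algebraMap ℝ ℂ) = 1 := by
    rw [← Matrix.map_mul, Matrix.mul_nonsing_inv _ hdet.isUnit]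
    simp
  have hmul' : A⁻¹.map (algebraMap ℝ ℂ) * A.map (algebraMap ℝ ℂ) = 1 := by
    rw [← Matrix.map_mul, Matrix.nonsing_inv_mul _ hdet.isUnit]
    simp
  let u : (Matrix (Fin 2) (Fin 2) ℂ)ˣ := ⟨_, _, hmul, hmul'⟩
  have hspec : ∀ μ ∈ spectrum ℂ (A⁻¹.map (algebraMap ℝ ℂ)), ‖μ‖ < 1 := by
    intro μ hμ
    have h' : μ⁻¹ ∈ spectrum ℂ (A.map (algebraMap ℝ ℂ)) := by
      have := spectrum.map_inv (𝕜 := ℂ) u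
      rw [← Set.mem_inv, this]
      exact hμ
    have h1 := hA _ h'
    rw [norm_inv] at h1
    exact (one_lt_inv_iff₀.1 h1).2
  refine ⟨_, summable_norm_pow_of_spectrum_lt_one hspec, fun n z => ?_⟩
  have hnorm : ∀ z : Fin 2 → ℝ, ‖fun i => (algebraMap ℝ ℂ) (z i)‖ = ‖z‖ := fun z => by
    simp [Pi.norm_def]
  have key : (fun i => (algebraMap ℝ ℂ) (((A⁻¹ ^ n) *ᵥ z) i)) =
      (A⁻¹.map (algebraMap ℝ ℂ) ^ n) *ᵥ fun i => (algebraMap ℝ ℂ) (z i) := by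
    rw [← Matrix.map_pow]
    ext i
    exact RingHom.map_mulVec (algebraMap ℝ ℂ) _ _ i
  rw [← hnorm, key, ← hnorm z]
  exact Matrix.linfty_opNorm_mulVec _ _

end Expanding

theorem IsExpandingMat.charpoly_root_abs {A : Matrix (Fin 2) (Fin 2) ℝ} (hA : IsExpandingMat A)
    {r : ℝ} (hr : r ^ 2 - A.trace * r + A.det = 0) : 1 < |r| := by
  have hmem : (r : ℂ) ∈ spectrum ℂ (A.map (algebraMap ℝ ℂ)) := by
    rw [spectrum.mem_iff, Matrix.isUnit_iff_isUnit_det, isUnit_iff_ne_zero, not_not,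
      Matrix.det_fin_two]
    rw [Matrix.det_fin_two, Matrix.trace_fin_two] at hr
    simp [Matrix.algebraMap_matrix_apply]
    norm_cast
    linear_combination hr
  simpa using hA _ hmem

theorem IsExpandingMat.exists_trace_det {A : Matrix (Fin 2) (Fin 2) ℝ} (hA : IsExpandingMat A)
    (hint : IsIntMat A) (hdet : |A.det| = 3) : ∃ t δ : ℤ, A.trace = t ∧ A.det = δ ∧
      ((δ = 3 ∧ t ∈ Finset.Icc (-3) 3) ∨ (δ = -3 ∧ t ∈ Finset.Icc (-1) 1)) := by
  obtain ⟨a, ha⟩ := hint 0 0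
  obtain ⟨d, hd⟩ := hint 1 1
  have htr : A.trace = ((a + d : ℤ) : ℝ) := by
    rw [Matrix.trace_fin_two, ha, hd]; push_cast; ring
  have hroot : ∀ r : ℝ, |r| ≤ 1 → r ^ 2 - A.trace * r + A.det ≠ 0 := fun r hr h =>
    (hA.charpoly_root_abs h).not_ge hr
  generalize a + d = t at htr
  have hneg : ∀ r ∈ Set.Icc (-1 : ℝ) 1, 0 < (r ^ 2 - A.trace * r + A.det) * A.det := by
    intro r hr
    by_contra! hle
    have hz : (0 : ℝ) ∈ (fun r : ℝ => (r ^ 2 - A.trace * r + A.det) * A.det) '' Set.uIcc r 0 := by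
      refine intermediate_value_uIcc (by fun_prop) (Set.mem_uIcc.2 (Or.inl ⟨hle, ?_⟩))
      nlinarith [mul_self_nonneg A.det]
    obtain ⟨s, hs, hs0⟩ := hz
    have hs1 : |s| ≤ 1 := by
      rw [abs_le]
      rcases Set.mem_uIcc.1 hs with h | h <;> constructor <;> linarith [h.1, h.2, hr.1, hr.2]
    have hd0 : A.det ≠ 0 := fun h => by simp [h] at hdet
    exact hroot s hs1 ((mul_eq_zero.1 hs0).resolve_right hd0)
  have h1 := hneg 1 (by norm_num)
  have h2 := hneg (-1) (by norm_num)
  rw [htr] at h1 h2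
  rcases (abs_eq (by norm_num)).1 hdet with h | h
  · refine ⟨t, 3, htr, by simpa using h, Or.inl ⟨rfl, ?_⟩⟩
    rw [h] at h1 h2
    have h3 : (t : ℝ) < (4 : ℤ) := by push_cast; linarith
    have h4 : ((-4 : ℤ) : ℝ) < t := by push_cast; linarith
    rw [Int.cast_lt] at h3 h4
    exact Finset.mem_Icc.2 ⟨by omega, by omega⟩
  · refine ⟨t, -3, htr, by simpa using h, Or.inr ⟨rfl, ?_⟩⟩
    rw [h] at h1 h2
    have h3 : (t : ℝ) < (2 : ℤ) := by push_cast; linarith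
    have h4 : ((-2 : ℤ) : ℝ) < t := by push_cast; linarith
    rw [Int.cast_lt] at h3 h4
    exact Finset.mem_Icc.2 ⟨by omega, by omega⟩

/-- The point `∑ B^{n+1} d_{ω n}` with digit sequence `ω`. -/
noncomputable def digitSum (B : Matrix (Fin 2) (Fin 2) ℝ) (d : Fin 3 → Fin 2 → ℝ)
    (ω : ℕ → Fin 3) : Fin 2 → ℝ :=
  ∑' n, (B ^ (n + 1)) *ᵥ d (ω n)

/-- Prepend a digit to a digit sequence. -/
def consDigit (i : Fin 3) (ω : ℕ → Fin 3) : ℕ → Fin 3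
  | 0 => i
  | n + 1 => ω n

theorem consDigit_head_tail (ω : ℕ → Fin 3) : consDigit (ω 0) (fun n => ω (n + 1)) = ω := by
  funext n; cases n <;> rfl

theorem exists_uniform_cylinder {g : (ℕ → Fin 3) → Bool} (hg : Continuous g) :
    ∃ N, ∀ ω ω', (∀ i < N, ω i = ω' i) → g ω = g ω' := by
  have hloc : ∀ ω, ∃ n, ∀ ω' ∈ PiNat.cylinder (E := fun _ => Fin 3) ω n, g ω' = g ω := by
    intro ω
    have hnhds : g ⁻¹' {g ω} ∈ nhds ω :=
      ((isOpen_discrete {g ω}).preimage hg).mem_nhds rfl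
    obtain ⟨_, ⟨ω₁, n, rfl⟩, hmem, hsub⟩ :=
      (PiNat.isTopologicalBasis_cylinders (fun _ => Fin 3)).mem_nhds_iff.1 hnhds
    rw [PiNat.mem_cylinder_iff_eq] at hmem
    exact ⟨n, fun ω' h => hsub (hmem ▸ h)⟩
  choose n hn using hloc
  obtain ⟨s, hs⟩ := isCompact_univ.elim_finite_subcover
    (fun ω => PiNat.cylinder (E := fun _ => Fin 3) ω (n ω))
    (fun ω => PiNat.isOpen_cylinder _ ω (n ω))
    (fun ω _ => Set.mem_iUnion.2 ⟨ω, PiNat.self_mem_cylinder ω _⟩)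
  refine ⟨s.sup n, fun ω ω' h => ?_⟩
  obtain ⟨ω₁, hω₁, hmem⟩ := Set.mem_iUnion₂.1 (hs (Set.mem_univ ω))
  rw [hn ω₁ ω hmem, hn ω₁ ω']
  rw [PiNat.mem_cylinder_iff] at hmem ⊢
  exact fun i hi => (h i (hi.trans_le (Finset.le_sup hω₁))).symm.trans (hmem i hi)

namespace HasSummablePowers

variable {B : Matrix (Fin 2) (Fin 2) ℝ} (hB : HasSummablePowers B) (d : Fin 3 → Fin 2 → ℝ)

include hB

theorem exists_summable_bound : ∃ u : ℕ → ℝ, Summable u ∧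
    ∀ n i, ‖(B ^ (n + 1)) *ᵥ d i‖ ≤ u n := by
  obtain ⟨c, hc, hle⟩ := hB
  refine ⟨fun n => |c (n + 1)| * ∑ i, ‖d i‖,
    (((summable_nat_add_iff 1).2 hc).abs).mul_right _, fun n i => (hle _ _).trans ?_⟩
  refine mul_le_mul (le_abs_self _) ?_ (norm_nonneg _) (abs_nonneg _)
  exact Finset.single_le_sum (f := fun i => ‖d i‖) (fun _ _ => norm_nonneg _) (Finset.mem_univ i)

theorem hasSum_digitSum (ω : ℕ → Fin 3) :
    HasSum (fun n => (B ^ (n + 1)) *ᵥ d (ω n)) (digitSum B d ω) := by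
  obtain ⟨u, hu, hle⟩ := hB.exists_summable_bound d
  exact (Summable.of_norm_bounded hu fun n => hle n (ω n)).hasSum

theorem continuous_digitSum : Continuous (digitSum B d) := by
  obtain ⟨u, hu, hle⟩ := hB.exists_summable_bound d
  refine continuous_tsum (fun n => ?_) hu fun n ω => hle n (ω n)
  exact (continuous_of_discreteTopology (f := fun i : Fin 3 => (B ^ (n + 1)) *ᵥ d i)).comp
    (continuous_apply n)

theorem digitSum_eq (ω : ℕ → Fin 3) :
    digitSum B d ω = B *ᵥ (d (ω 0) + digitSum B d fun n => ω (n + 1)) := by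
  have h1 := (hB.hasSum_digitSum d fun n => ω (n + 1)).map
    (Matrix.mulVecLin B) (Matrix.mulVecLin B).continuous_of_finiteDimensional
  have h2 := (hasSum_nat_add_iff' 1).2 (hB.hasSum_digitSum d ω)
  have h3 : (Matrix.mulVecLin B ∘ fun n => (B ^ (n + 1)) *ᵥ d (ω (n + 1))) =
      fun n => (B ^ (n + 1 + 1)) *ᵥ d (ω (n + 1)) := by
    funext n
    rw [Function.comp_apply, Matrix.mulVecLin_apply, Matrix.mulVec_mulVec, ← pow_succ']
  rw [h3] at h1
  have h4 := h2.unique h1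
  simp only [Finset.sum_range_one, zero_add, pow_one, Matrix.mulVecLin_apply] at h4
  rw [Matrix.mulVec_add, ← h4]
  abel

theorem digitSum_consDigit (i : Fin 3) (ω : ℕ → Fin 3) :
    digitSum B d (consDigit i ω) = B *ᵥ (d i + digitSum B d ω) :=
  hB.digitSum_eq d (consDigit i ω)

theorem exists_norm_digitSum_le : ∃ M, ∀ ω, ‖digitSum B d ω‖ ≤ M := by
  obtain ⟨M, hM⟩ := (isCompact_range (hB.continuous_digitSum d)).isBounded.exists_norm_le
  exact ⟨M, fun ω => hM _ ⟨ω, rfl⟩⟩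

theorem eq_zero_of_backward_orbit {e : ℕ → Fin 2 → ℝ} {M : ℝ} (hM : ∀ n, ‖e n‖ ≤ M)
    (he : ∀ n, e n = B *ᵥ e (n + 1)) : e 0 = 0 := by
  obtain ⟨c, hc, hle⟩ := hB
  have hpow : ∀ n, e 0 = (B ^ n) *ᵥ e n := by
    intro n
    induction n with
    | zero => simp
    | succ n ih => rw [ih, he n, Matrix.mulVec_mulVec, pow_succ]
  have hbound : ∀ n, ‖e 0‖ ≤ |c n| * M := fun n => by
    rw [hpow n]
    exact (hle n _).trans (mul_le_mul (le_abs_self _) (hM n) (norm_nonneg _) (abs_nonneg _))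
  have hlim : Filter.Tendsto (fun n => |c n| * M) Filter.atTop (nhds 0) := by
    simpa using hc.tendsto_atTop_zero.abs.mul_const M
  exact norm_le_zero_iff.1 (ge_of_tendsto' hlim hbound)

/-- A bounded orbit of `s ↦ B⁻¹ s - (d_ω - d_ω')` is a difference of two digit sums. -/
theorem digitSum_sub_digitSum {s : ℕ → Fin 2 → ℝ} {M : ℝ} (hM : ∀ n, ‖s n‖ ≤ M)
    {ω ω' : ℕ → Fin 3} (hs : ∀ n, s n = B *ᵥ (d (ω n) - d (ω' n) + s (n + 1))) :
    digitSum B d ω - digitSum B d ω' = s 0 := by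
  obtain ⟨M', hM'⟩ := hB.exists_norm_digitSum_le d
  have := hB.eq_zero_of_backward_orbit
    (e := fun n => digitSum B d (fun m => ω (n + m)) - digitSum B d (fun m => ω' (n + m)) - s n)
    (M := M' + M' + M) (fun n => ?_) fun n => ?_
  · simpa [sub_eq_zero] using this
  · exact (norm_sub_le _ _).trans (add_le_add ((norm_sub_le _ _).trans
      (add_le_add (hM' _) (hM' _))) (hM n))
  · rw [hs n, hB.digitSum_eq d (fun m => ω (n + m)), hB.digitSum_eq d (fun m => ω' (n + m)),
      ← Matrix.mulVec_sub, ← Matrix.mulVec_sub]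
    simp only [add_zero, add_assoc, add_comm 1]
    congr 1
    abel

/-- Hata's criterion: if every colouring of the digits which is constant on overlapping pieces is
constant, then the self-affine set is connected. -/
theorem isPreconnected_range_digitSum
    (H : ∀ c : Fin 3 → Bool, (∀ ω ω', digitSum B d ω = digitSum B d ω' → c (ω 0) = c (ω' 0)) →
      ∀ i j, c i = c j) : IsPreconnected (Set.range (digitSum B d)) := by
  have main : ∀ (n : ℕ) (g : (ℕ → Fin 3) → Bool),
      (∀ ω ω', digitSum B d ω = digitSum B d ω' → g ω = g ω') →
      (∀ ω ω', (∀ i < n, ω i = ω' i) → g ω = g ω') → ∀ ω ω', g ω = g ω' := by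
    intro n
    induction n with
    | zero => exact fun g _ h ω ω' => h ω ω' (by simp)
    | succ n ih =>
      intro g hfac hn
      have hcons : ∀ i ω ω', g (consDigit i ω) = g (consDigit i ω') := by
        refine fun i => ih (fun ω => g (consDigit i ω)) (fun ω ω' h => hfac _ _ ?_)
          fun ω ω' h => hn _ _ fun j hj => ?_
        · rw [hB.digitSum_consDigit, hB.digitSum_consDigit, h]
        · cases j with
          | zero => rfl
          | succ j => exact h j (by omega)
      have hhead : ∀ ω, g ω = g (consDigit (ω 0) fun _ => 0) := fun ω => by
        conv_lhs => rw [← consDigit_head_tail ω]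
        exact hcons _ _ _
      intro ω ω'
      rw [hhead ω, hhead ω']
      refine H (fun i => g (consDigit i fun _ => 0)) (fun ω ω' h => ?_) _ _
      rw [← hhead, ← hhead]
      exact hfac _ _ h
  refine isPreconnected_of_forall_constant fun f hf => ?_
  rintro _ ⟨ω, rfl⟩ _ ⟨ω', rfl⟩
  obtain ⟨N, hN⟩ := exists_uniform_cylinder (g := fun ω => f (digitSum B d ω))
    (hf.comp_continuous (hB.continuous_digitSum d) fun ω => ⟨ω, rfl⟩)
  exact main N (fun ω => f (digitSum B d ω)) (fun _ _ h => by simp only [h]) hN ω ω'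

theorem not_isPreconnected_range_digitSum {i j : Fin 3} (hij : j ≠ i)
    (H : ∀ ω ω', digitSum B d ω = digitSum B d ω' → ω 0 = i → ω' 0 = i) :
    ¬ IsPreconnected (Set.range (digitSum B d)) := by
  intro hpre
  have hcl : ∀ s : Set (Fin 3), IsClosed (digitSum B d '' {ω | ω 0 ∈ s}) := fun s =>
    (((isClosed_discrete s).preimage (continuous_apply (0 : ℕ))).isCompact.image
      (hB.continuous_digitSum d)).isClosed
  obtain ⟨x, -, ⟨ω, hω, rfl⟩, ω', hω', h⟩ := isPreconnected_closed_iff.1 hpre _ _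
    (hcl {i}) (hcl {i}ᶜ) (by
      rintro _ ⟨ω, rfl⟩
      by_cases h : ω 0 = i
      · exact Or.inl ⟨ω, h, rfl⟩
      · exact Or.inr ⟨ω, h, rfl⟩)
    ⟨_, ⟨fun _ => i, rfl⟩, fun _ => i, rfl, rfl⟩ ⟨_, ⟨fun _ => j, rfl⟩, fun _ => j, hij, rfl⟩
  exact hω' (H ω ω' h.symm hω)

theorem selfAffine_inv_eq_range {A : Matrix (Fin 2) (Fin 2) ℝ} (hA : B = A⁻¹) :
    selfAffine A (Set.range d) = Set.range (digitSum B d) := by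
  subst hA
  ext x
  constructor
  · rintro ⟨e, he, hx⟩
    choose ω hω using he
    refine ⟨ω, (hB.hasSum_digitSum d ω).unique ?_⟩
    simpa only [hω] using hx
  · rintro ⟨ω, rfl⟩
    exact ⟨fun n => d (ω n), fun n => ⟨_, rfl⟩, hB.hasSum_digitSum d ω⟩

end HasSummablePowers

/-- Integer coordinates, with respect to `v` and `A v`, of the digits `0`, `v`, `k A v`. -/
def digitCoord (k : ℤ) : Fin 3 → ℤ × ℤ := ![(0, 0), (1, 0), (0, k)]

/-- The coordinates of `A s - (d i - d j)`, where `A² = t A - δ`. -/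
def orbitStep (t δ k : ℤ) (s : ℤ × ℤ) (i j : Fin 3) : ℤ × ℤ :=
  (-δ * s.2 - ((digitCoord k i).1 - (digitCoord k j).1),
    s.1 + t * s.2 - ((digitCoord k i).2 - (digitCoord k j).2))

/-- `S` is a finite set of lattice points from each of which `orbitStep` can stay in `S`. -/
def IsOrbitClosed (t δ k : ℤ) (S : Finset (ℤ × ℤ)) : Prop :=
  ∀ s ∈ S, ∃ i j, orbitStep t δ k s i j ∈ S

instance (t δ k : ℤ) (S : Finset (ℤ × ℤ)) : Decidable (IsOrbitClosed t δ k S) := by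
  unfold IsOrbitClosed; infer_instance

theorem exists_isOrbitClosed {t δ k : ℤ}
    (htδ : (δ = 3 ∧ t ∈ Finset.Icc (-3) 3) ∨ (δ = -3 ∧ t ∈ Finset.Icc (-1) 1))
    (hk : k = 1 ∨ k = -1) :
    ∃ S, IsOrbitClosed t δ k S ∧ (1, 0) ∈ S ∧ ((0, k) ∈ S ∨ (-1, k) ∈ S) := by
  simp only [Finset.mem_Icc] at htδ
  rcases htδ with ⟨rfl, h₁, h₂⟩ | ⟨rfl, h₁, h₂⟩ <;> interval_cases t <;> rcases hk with rfl | rfl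
  · exact ⟨{(-5, -2), (-4, -2), (0, 1), (1, 0), (5, 2)}, by decide⟩
  · exact ⟨{(-3, -1), (-1, -1), (0, 0), (1, 0), (3, 1)}, by decide⟩
  · exact ⟨{(-3, -1), (0, 1), (1, 0), (2, 0)}, by decide⟩
  · exact ⟨{(-2, 0), (0, -1), (0, 0), (1, 0), (2, 1)}, by decide⟩
  · exact ⟨{(-2, -1), (0, 1), (1, 0), (2, 0)}, by decide⟩
  · exact ⟨{(-2, 0), (0, -1), (0, 1), (1, 0), (2, 0)}, by decide⟩
  · exact ⟨{(-2, 0), (0, -1), (0, 1), (1, 0), (2, 0)}, by decide⟩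
  · exact ⟨{(-2, 0), (-1, 1), (0, -1), (1, 0), (2, 0)}, by decide⟩
  · exact ⟨{(-2, 0), (0, -1), (0, 1), (1, 0), (2, 0)}, by decide⟩
  · exact ⟨{(-2, 0), (-1, 1), (0, -1), (1, 0), (2, -1), (2, 0)}, by decide⟩
  · exact ⟨{(-2, 0), (-2, 1), (0, -1), (0, 1), (1, 0), (2, -1), (2, 0)}, by decide⟩
  · exact ⟨{(-2, 1), (-1, 1), (0, -1), (1, 0), (2, 0), (3, -1)}, by decide⟩
  · exact ⟨{(-2, 1), (-1, 1), (1, 0)}, by decide⟩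
  · exact ⟨{(0, -1), (0, 0), (1, 0), (4, -2), (5, -2)}, by decide⟩
  · exact ⟨{(0, 1), (1, 0), (2, 0)}, by decide⟩
  · exact ⟨{(-3, -1), (-1, -1), (0, 0), (1, 0)}, by decide⟩
  · exact ⟨{(0, 1), (1, 0), (2, 0)}, by decide⟩
  · exact ⟨{(-2, -1), (-1, -1), (0, 0), (1, 0)}, by decide⟩
  · exact ⟨{(-3, 1), (-1, 1), (1, 0), (3, -1)}, by decide⟩
  · exact ⟨{(-2, 0), (0, -1), (0, 0), (1, 0)}, by decide⟩

theorem IsOrbitClosed.exists_orbit {t δ k : ℤ} {S : Finset (ℤ × ℤ)} (hS : IsOrbitClosed t δ k S)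
    {s₀ : ℤ × ℤ} (h₀ : s₀ ∈ S) : ∃ (s : ℕ → ℤ × ℤ) (ω ω' : ℕ → Fin 3), s 0 = s₀ ∧
      (∀ n, s n ∈ S) ∧ ∀ n, s (n + 1) = orbitStep t δ k (s n) (ω n) (ω' n) := by
  choose i j hij using fun s : S => hS s s.2
  let next : S → S := fun s => ⟨orbitStep t δ k s (i s) (j s), hij s⟩
  let orb : ℕ → S := fun n => next^[n] ⟨s₀, h₀⟩
  refine ⟨fun n => orb n, fun n => i (orb n), fun n => j (orb n), rfl, fun n => (orb n).2,
    fun n => ?_⟩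
  simp only [orb, Function.iterate_succ_apply']
  rfl

/-- The digits `0`, `v`, `k u`. -/
def planeDigit (v u : Fin 2 → ℝ) (k : ℤ) : Fin 3 → Fin 2 → ℝ := ![0, v, (k : ℝ) • u]

theorem planeDigit_eq (v u : Fin 2 → ℝ) (k : ℤ) (i : Fin 3) :
    planeDigit v u k i = ((digitCoord k i).1 : ℝ) • v + ((digitCoord k i).2 : ℝ) • u := by
  fin_cases i <;> simp [planeDigit, digitCoord]

theorem range_planeDigit (v u : Fin 2 → ℝ) (k : ℤ) :
    Set.range (planeDigit v u k) = {0, v, (k : ℝ) • u} := by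
  ext x
  constructor
  · rintro ⟨i, rfl⟩
    fin_cases i <;> simp [planeDigit]
  · rintro (rfl | rfl | rfl)
    exacts [⟨0, rfl⟩, ⟨1, rfl⟩, ⟨2, rfl⟩]

theorem mulVec_mulVec_eq_trace_det (A : Matrix (Fin 2) (Fin 2) ℝ) (v : Fin 2 → ℝ) :
    A *ᵥ (A *ᵥ v) = A.trace • (A *ᵥ v) - A.det • v := by
  ext i
  fin_cases i <;>
    simp [Matrix.mulVec, dotProduct, Fin.sum_univ_two, Matrix.trace_fin_two, Matrix.det_fin_two] <;>
    ring

theorem inv_mulVec_mulVec {A : Matrix (Fin 2) (Fin 2) ℝ} (hdet : A.det ≠ 0) (z : Fin 2 → ℝ) :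
    A⁻¹ *ᵥ (A *ᵥ z) = z := by
  rw [Matrix.mulVec_mulVec, Matrix.nonsing_inv_mul _ hdet.isUnit, Matrix.one_mulVec]

theorem mulVec_inv_mulVec {A : Matrix (Fin 2) (Fin 2) ℝ} (hdet : A.det ≠ 0) (z : Fin 2 → ℝ) :
    A *ᵥ (A⁻¹ *ᵥ z) = z := by
  rw [Matrix.mulVec_mulVec, Matrix.mul_nonsing_inv _ hdet.isUnit, Matrix.one_mulVec]

section Plane

variable {A : Matrix (Fin 2) (Fin 2) ℝ} {t δ k : ℤ} {v : Fin 2 → ℝ}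

theorem IsOrbitClosed.exists_digitSum_eq (hB : HasSummablePowers A⁻¹) (htr : A.trace = t)
    (hdet : A.det = δ) (hdet0 : A.det ≠ 0) {S : Finset (ℤ × ℤ)} (hS : IsOrbitClosed t δ k S)
    {i j : Fin 3} (hij : digitCoord k j - digitCoord k i ∈ S) :
    ∃ ω ω' : ℕ → Fin 3, ω 0 = i ∧ ω' 0 = j ∧
      digitSum A⁻¹ (planeDigit v (A *ᵥ v) k) ω = digitSum A⁻¹ (planeDigit v (A *ᵥ v) k) ω' := by
  obtain ⟨s, ω, ω', hs₀, hmem, hstep⟩ := hS.exists_orbit hij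
  set d := planeDigit v (A *ᵥ v) k with hd
  let P : ℤ × ℤ → Fin 2 → ℝ := fun p => (p.1 : ℝ) • v + (p.2 : ℝ) • (A *ᵥ v)
  have hbound : ∀ n, ‖P (s n)‖ ≤ ∑ p ∈ S, ‖P p‖ := fun n =>
    Finset.single_le_sum (f := fun p => ‖P p‖) (fun _ _ => norm_nonneg _) (hmem n)
  have horb : ∀ n, P (s n) = A⁻¹ *ᵥ (d (ω n) - d (ω' n) + P (s (n + 1))) := fun n => by
    have : d (ω n) - d (ω' n) + P (s (n + 1)) = A *ᵥ P (s n) := by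
      simp only [P, hstep, orbitStep, hd, planeDigit_eq, Matrix.mulVec_add, Matrix.mulVec_smul,
        mulVec_mulVec_eq_trace_det, htr, hdet]
      push_cast
      module
    rw [this, inv_mulVec_mulVec hdet0]
  have hsub := hB.digitSum_sub_digitSum d hbound horb
  refine ⟨consDigit i ω, consDigit j ω', rfl, rfl, ?_⟩
  have hP : P (s 0) = d j - d i := by
    simp only [P, hs₀, hd, planeDigit_eq, Prod.fst_sub, Prod.snd_sub]
    push_cast
    module
  rw [hB.digitSum_consDigit, hB.digitSum_consDigit]
  congr 1
  rw [hP] at hsub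
  rw [sub_eq_iff_eq_add.1 hsub]
  abel

theorem isPreconnected_of_abs_eq_one (hB : HasSummablePowers A⁻¹) (htr : A.trace = t)
    (hdet : A.det = δ) (hdet0 : A.det ≠ 0)
    (htδ : (δ = 3 ∧ t ∈ Finset.Icc (-3) 3) ∨ (δ = -3 ∧ t ∈ Finset.Icc (-1) 1))
    (hk : k = 1 ∨ k = -1) :
    IsPreconnected (Set.range (digitSum A⁻¹ (planeDigit v (A *ᵥ v) k))) := by
  obtain ⟨S, hS, h01, h2⟩ := exists_isOrbitClosed htδ hk
  refine hB.isPreconnected_range_digitSum _ fun c hc => ?_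
  have hcol : ∀ i j, digitCoord k j - digitCoord k i ∈ S → c i = c j := fun i j hij => by
    obtain ⟨ω, ω', rfl, rfl, h⟩ := hS.exists_digitSum_eq (v := v) hB htr hdet hdet0 hij
    exact hc _ _ h
  have e01 : c 0 = c 1 := hcol 0 1 (by simpa [digitCoord] using h01)
  have e2 : c 0 = c 2 := by
    rcases h2 with h | h
    · exact hcol 0 2 (by simpa [digitCoord] using h)
    · exact e01.trans (hcol 1 2 (by simpa [digitCoord] using h))
  have e : ∀ i, c i = c 0 := fun i => by
    fin_cases i
    exacts [rfl, e01.symm, e2.symm]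
  exact fun i j => (e i).trans (e j).symm

theorem digitCoord_sub (k : ℤ) (i j : Fin 3) : ∃ a b : ℤ, |a| ≤ 1 ∧ |b| ≤ 1 ∧ |a + b| ≤ 1 ∧
    (digitCoord k i).1 - (digitCoord k j).1 = a ∧
    (digitCoord k i).2 - (digitCoord k j).2 = k * b := by
  fin_cases i <;> fin_cases j
  · exact ⟨0, 0, by simp [digitCoord]⟩
  · exact ⟨-1, 0, by simp [digitCoord]⟩
  · exact ⟨0, -1, by simp [digitCoord]⟩
  · exact ⟨1, 0, by simp [digitCoord]⟩
  · exact ⟨0, 0, by simp [digitCoord]⟩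
  · exact ⟨1, -1, by simp [digitCoord]⟩
  · exact ⟨0, 1, by simp [digitCoord]⟩
  · exact ⟨-1, 1, by simp [digitCoord]⟩
  · exact ⟨0, 0, by simp [digitCoord]⟩

theorem abs_two_mul_add_mul_le {k a b : ℤ} (hk : 2 ≤ k) (hb : |b| ≤ 1)
    (hab : |a + b| ≤ 1) : |2 * a + k * b| ≤ k := by
  rw [abs_le] at *
  constructor <;> nlinarith

theorem false_of_bounded_orbit
    (htδ : (δ = 3 ∧ t ∈ Finset.Icc (-3) 3) ∨ (δ = -3 ∧ t ∈ Finset.Icc (-1) 1)) (hk : 2 ≤ k)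
    {x y : ℕ → ℝ} {a b : ℕ → ℤ} (ha : ∀ n, |a n| ≤ 1) (hb : ∀ n, |b n| ≤ 1)
    (hab : ∀ n, |a n + b n| ≤ 1) (hx : ∀ n, x (n + 1) = -δ * y n - a n)
    (hy : ∀ n, y (n + 1) = x n + t * y n - k * b n) (hx0 : x 0 = 0 ∨ x 0 = -1) (hy0 : y 0 = k)
    (hxb : ∃ M, ∀ n, |x n| ≤ M) (hyb : ∃ M, ∀ n, |y n| ≤ M) : False := by
  have horb : IsOrbit t δ k x y (fun n => a n) (fun n => k * b n) := by
    refine ⟨hx, hy, fun n => mod_cast ha n, fun n => ?_, fun n => ?_⟩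
    · rw [abs_mul, abs_of_nonneg (by positivity : (0 : ℝ) ≤ k)]
      exact mul_le_of_le_one_right (by positivity) (mod_cast hb n)
    · exact_mod_cast abs_two_mul_add_mul_le hk (hb n) (hab n)
  have hk' : (2 : ℝ) ≤ k := by exact_mod_cast hk
  simp only [Finset.mem_Icc] at htδ
  rcases htδ with ⟨rfl, h₁, h₂⟩ | ⟨rfl, h₁, h₂⟩
  · push_cast at horb
    refine horb.not_bounded_of_det_three hk' ?_ hx0 hy0 hyb
    interval_cases t <;> norm_num
  · push_cast at horb
    refine horb.not_bounded_of_det_neg_three hk' ?_ hx0 hy0 hxb hyb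
    interval_cases t <;> norm_num

/-- The sign change `A ↦ -A`, `k ↦ -k` reduces negative `k` to positive `k`. -/
theorem false_of_bounded_orbit_of_two_le_abs
    (htδ : (δ = 3 ∧ t ∈ Finset.Icc (-3) 3) ∨ (δ = -3 ∧ t ∈ Finset.Icc (-1) 1)) (hk : 2 ≤ |k|)
    {x y : ℕ → ℝ} {a b : ℕ → ℤ} (ha : ∀ n, |a n| ≤ 1) (hb : ∀ n, |b n| ≤ 1)
    (hab : ∀ n, |a n + b n| ≤ 1) (hx : ∀ n, x (n + 1) = -δ * y n - a n)
    (hy : ∀ n, y (n + 1) = x n + t * y n - k * b n) (hx0 : x 0 = 0 ∨ x 0 = -1) (hy0 : y 0 = k)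
    (hxb : ∃ M, ∀ n, |x n| ≤ M) (hyb : ∃ M, ∀ n, |y n| ≤ M) : False := by
  rcases le_abs.1 hk with hk | hk
  · exact false_of_bounded_orbit htδ hk ha hb hab hx hy hx0 hy0 hxb hyb
  · have hsgn : ∀ (n : ℕ) (z : ℤ), |-(-1) ^ n * z| = |z| := fun n z => by simp [abs_mul]
    have hsgn' : ∀ (n : ℕ) (z : ℝ), |(-1) ^ n * z| = |z| := fun n z => by simp [abs_mul]
    refine false_of_bounded_orbit (t := -t) (δ := δ) (k := -k)
      (x := fun n => (-1) ^ n * x n) (y := fun n => (-1) ^ n * -y n)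
      (a := fun n => -(-1) ^ n * a n) (b := fun n => -(-1) ^ n * b n) ?_ hk
      (fun n => by rw [hsgn]; exact ha n) (fun n => by rw [hsgn]; exact hb n)
      (fun n => by rw [← mul_add, hsgn]; exact hab n) (fun n => ?_) (fun n => ?_)
      (by simpa using hx0) (by simp [hy0]) (by simpa only [hsgn'] using hxb)
      (by simpa only [hsgn', abs_neg] using hyb)
    · simp only [Finset.mem_Icc] at htδ ⊢
      omega
    · rw [hx]; push_cast; ring
    · rw [hy]; push_cast; ring

theorem not_isPreconnected_of_two_le_abs (hB : HasSummablePowers A⁻¹) (htr : A.trace = t)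
    (hdet : A.det = δ) (hdet0 : A.det ≠ 0)
    (htδ : (δ = 3 ∧ t ∈ Finset.Icc (-3) 3) ∨ (δ = -3 ∧ t ∈ Finset.Icc (-1) 1))
    (hv : LinearIndependent ℝ ![v, A *ᵥ v]) (hk : 2 ≤ |k|) :
    ¬ IsPreconnected (Set.range (digitSum A⁻¹ (planeDigit v (A *ᵥ v) k))) := by
  set d := planeDigit v (A *ᵥ v) k with hd
  refine hB.not_isPreconnected_range_digitSum d (i := 2) (j := 0) (by decide)
    fun ω ω' heq h2 => ?_
  by_contra hne
  let b := basisOfLinearIndependentOfCardEqFinrank hv (by simp)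
  have hb0 : b 0 = v := by simp [b]
  have hb1 : b 1 = A *ᵥ v := by simp [b]
  let s : ℕ → Fin 2 → ℝ := fun n =>
    digitSum A⁻¹ d (fun m => ω' (n + 1 + m)) - digitSum A⁻¹ d (fun m => ω (n + 1 + m))
  have hdecomp : ∀ z, z = b.coord 0 z • v + b.coord 1 z • (A *ᵥ v) := fun z => by
    have hz := b.sum_repr z
    rw [Fin.sum_univ_two, hb0, hb1] at hz
    exact hz.symm
  have hcoord : ∀ p q : ℝ, b.coord 0 (p • v + q • (A *ᵥ v)) = p ∧
      b.coord 1 (p • v + q • (A *ᵥ v)) = q := fun p q => by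
    rw [← hb1, ← hb0]
    simp
  have hstep : ∀ n, s (n + 1) = A *ᵥ s n - (d (ω' (n + 1)) - d (ω (n + 1))) := fun n => by
    simp only [s]
    rw [hB.digitSum_eq d (fun m => ω' (n + 1 + m)), hB.digitSum_eq d (fun m => ω (n + 1 + m)),
      ← Matrix.mulVec_sub, mulVec_inv_mulVec hdet0]
    simp only [add_zero, add_assoc, add_comm 1]
    abel
  have hs0 : s 0 = d (ω 0) - d (ω' 0) := by
    rw [hB.digitSum_eq, hB.digitSum_eq d ω'] at heq
    have := congrArg (A *ᵥ ·) heq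
    simp only [mulVec_inv_mulVec hdet0] at this
    simp only [s, zero_add, add_comm 1]
    rw [sub_eq_sub_iff_add_eq_add, add_comm, this, add_comm]
  obtain ⟨M, hM⟩ := hB.exists_norm_digitSum_le d
  have hbdd : ∀ i, ∃ C, ∀ n, |b.coord i (s n)| ≤ C := fun i => by
    refine ⟨‖(b.coord i).toContinuousLinearMap‖ * (M + M), fun n => ?_⟩
    refine ((b.coord i).toContinuousLinearMap.le_opNorm (s n)).trans ?_
    gcongr
    exact (norm_sub_le _ _).trans (add_le_add (hM _) (hM _))
  choose α β hα hβ hαβ hα' hβ' using fun n => digitCoord_sub k (ω' (n + 1)) (ω (n + 1))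
  have hsucc : ∀ n, s (n + 1) = (-δ * b.coord 1 (s n) - α n) • v +
      (b.coord 0 (s n) + t * b.coord 1 (s n) - k * β n) • (A *ᵥ v) := fun n => by
    have h1 : (k : ℝ) * β n = (digitCoord k (ω' (n + 1))).2 - (digitCoord k (ω (n + 1))).2 := by
      exact_mod_cast (hβ' n).symm
    have h2 : (α n : ℝ) = (digitCoord k (ω' (n + 1))).1 - (digitCoord k (ω (n + 1))).1 := by
      exact_mod_cast (hα' n).symm
    rw [hstep, h1, h2]
    conv_lhs => rw [hdecomp (s n)]
    simp only [hd, planeDigit_eq, Matrix.mulVec_add, Matrix.mulVec_smul,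
      mulVec_mulVec_eq_trace_det, htr, hdet]
    module
  have hdig : ((digitCoord k (ω' 0)).1 = 0 ∨ (digitCoord k (ω' 0)).1 = 1) ∧
      (digitCoord k (ω' 0)).2 = 0 := by
    revert hne
    generalize ω' 0 = j
    fin_cases j <;> simp [digitCoord]
  have hs0' : s 0 = (-((digitCoord k (ω' 0)).1 : ℝ)) • v + (k : ℝ) • (A *ᵥ v) := by
    rw [hs0, h2, hd, planeDigit_eq, planeDigit_eq, hdig.2]
    simp only [digitCoord, Matrix.cons_val]
    push_cast
    module
  refine false_of_bounded_orbit_of_two_le_abs htδ hk (x := fun n => b.coord 0 (s n))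
    (y := fun n => b.coord 1 (s n)) hα hβ hαβ (fun n => ?_) (fun n => ?_) ?_ ?_ (hbdd 0) (hbdd 1)
  · rw [hsucc, (hcoord _ _).1]
  · rw [hsucc, (hcoord _ _).2]
  · rw [hs0', (hcoord _ _).1]
    rcases hdig.1 with h | h <;> simp [h]
  · rw [hs0', (hcoord _ _).2]

end Plane

theorem stmt18 (A : Matrix (Fin 2) (Fin 2) ℝ)
    (hint : IsIntMat A) (hexp : IsExpandingMat A)
    (hdet : |A.det| = 3)
    (k : ℤ) (hk : k ≠ 0)
    (v : Fin 2 → ℝ) (hvint : ∀ i, ∃ m : ℤ, v i = (m : ℝ))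
    (hv : LinearIndependent ℝ ![v, A *ᵥ v])
    (D : Set (Fin 2 → ℝ)) (hD : D = {0, v, (k : ℝ) • (A *ᵥ v)}) :
    IsConnected (selfAffine A D) ↔ k = 1 ∨ k = -1 := by
  have hdet0 : A.det ≠ 0 := fun h => by simp [h] at hdet
  have hB := hexp.hasSummablePowers_inv hdet0
  obtain ⟨t, δ, htr, hδ, htδ⟩ := hexp.exists_trace_det hint hdet
  rw [hD, ← range_planeDigit, hB.selfAffine_inv_eq_range _ rfl]
  refine ⟨fun h => ?_, fun h => ⟨Set.range_nonempty _,
    isPreconnected_of_abs_eq_one hB htr hδ hdet0 htδ h⟩⟩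
  by_contra hne
  refine not_isPreconnected_of_two_le_abs hB htr hδ hdet0 htδ hv ?_ h.isPreconnected
  rw [le_abs]
  omega
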